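/- Define the vector fields f₁, f₂ : ℝ³ → ℝ³ by f₁(x) = (1, 0, −x₂²) and f₂(x) = (0, 1, x₁²), and let [f, g] denote the Lie bracket [f, g](x) = Dg(x)·f(x) − Df(x)·g(x). Then for every x ∈ ℝ³, the determinant of the 3×3 matrix with columns f₁(x), f₂(x), [[f₁, f₂], f₁](x) equals −2; in particular these three vectors form a basis of ℝ³ for every x ∈ ℝ³. -/

import Mathlib

/-- The Lie bracket of vector fields `f, g : ℝⁿ → ℝⁿ`:
`[f, g](x) = Dg(x)·f(x) − Df(x)·g(x)`. -/
noncomputable def lieBracket {n : ℕ} (f g : (Fin n → ℝ) → (Fin n → ℝ)) :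
    (Fin n → ℝ) → (Fin n → ℝ) :=
  fun x => fderiv ℝ g x (f x) - fderiv ℝ f x (g x)

/-- The vector field `f₁(x) = (1, 0, −x₂²)` of the rigid body with oscillators. -/
noncomputable def bodyF₁ : (Fin 3 → ℝ) → (Fin 3 → ℝ) :=
  fun x => ![1, 0, -(x 1) ^ 2]

/-- The vector field `f₂(x) = (0, 1, x₁²)` of the rigid body with oscillators. -/
noncomputable def bodyF₂ : (Fin 3 → ℝ) → (Fin 3 → ℝ) :=
  fun x => ![0, 1, (x 0) ^ 2]

theorem lieBracket_eq_of_hasFDerivAt {n : ℕ} {f g : (Fin n → ℝ) → (Fin n → ℝ)}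
    {f' g' : (Fin n → ℝ) →L[ℝ] (Fin n → ℝ)} {x : Fin n → ℝ}
    (hf : HasFDerivAt f f' x) (hg : HasFDerivAt g g' x) :
    lieBracket f g x = g' (f x) - f' (g x) := by
  rw [lieBracket, hf.fderiv, hg.fderiv]

theorem hasFDerivAt_vecCons_const {φ : (Fin 3 → ℝ) → ℝ} {φ' : (Fin 3 → ℝ) →L[ℝ] ℝ}
    {x : Fin 3 → ℝ} (a b : ℝ) (h : HasFDerivAt φ φ' x) :
    HasFDerivAt (fun y => ![a, b, φ y]) (ContinuousLinearMap.pi ![0, 0, φ']) x := by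
  rw [hasFDerivAt_pi']
  intro i
  fin_cases i
  · exact hasFDerivAt_const a x
  · exact hasFDerivAt_const b x
  · exact h

theorem hasFDerivAt_bodyF₁ (x : Fin 3 → ℝ) :
    HasFDerivAt bodyF₁ (ContinuousLinearMap.pi
      ![0, 0, -((2 * x 1) • ContinuousLinearMap.proj (R := ℝ) (φ := fun _ : Fin 3 => ℝ) 1)]) x :=
  hasFDerivAt_vecCons_const 1 0 (by simpa using ((hasFDerivAt_apply (𝕜 := ℝ) 1 x).pow 2).fun_neg)

theorem hasFDerivAt_bodyF₂ (x : Fin 3 → ℝ) :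
    HasFDerivAt bodyF₂ (ContinuousLinearMap.pi
      ![0, 0, (2 * x 0) • ContinuousLinearMap.proj (R := ℝ) (φ := fun _ : Fin 3 => ℝ) 0]) x :=
  hasFDerivAt_vecCons_const 0 1 (by simpa using (hasFDerivAt_apply (𝕜 := ℝ) 0 x).pow 2)

theorem lieBracket_bodyF₁_bodyF₂ :
    lieBracket bodyF₁ bodyF₂ = fun x => ![0, 0, 2 * (x 0 + x 1)] := by
  funext x
  rw [lieBracket_eq_of_hasFDerivAt (hasFDerivAt_bodyF₁ x) (hasFDerivAt_bodyF₂ x)]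
  ext i
  fin_cases i <;> simp [bodyF₁, bodyF₂, mul_add]

theorem lieBracket_lieBracket_bodyF₁_bodyF₂_bodyF₁ (x : Fin 3 → ℝ) :
    lieBracket (lieBracket bodyF₁ bodyF₂) bodyF₁ x = ![0, 0, -2] := by
  have h := hasFDerivAt_vecCons_const 0 0
    (((hasFDerivAt_apply (𝕜 := ℝ) 0 x).fun_add (hasFDerivAt_apply (𝕜 := ℝ) 1 x)).const_mul 2)
  rw [lieBracket_bodyF₁_bodyF₂, lieBracket_eq_of_hasFDerivAt h (hasFDerivAt_bodyF₁ x)]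
  ext i
  fin_cases i <;> simp [bodyF₁]

/-- Second-order controllability rank condition for the rigid body with oscillators:
the matrix with columns `f₁(x), f₂(x), [[f₁, f₂], f₁](x)` has determinant `−2`, so
these three vectors form a basis of `ℝ³` for every `x ∈ ℝ³`. -/
theorem body_rank_condition (x : Fin 3 → ℝ) :
    (Matrix.of fun i j : Fin 3 =>
        ![bodyF₁ x, bodyF₂ x, lieBracket (lieBracket bodyF₁ bodyF₂) bodyF₁ x] j i).det
      = -2 ∧
    LinearIndependent ℝ
      ![bodyF₁ x, bodyF₂ x, lieBracket (lieBracket bodyF₁ bodyF₂) bodyF₁ x] ∧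
    Submodule.span ℝ
        (Set.range ![bodyF₁ x, bodyF₂ x, lieBracket (lieBracket bodyF₁ bodyF₂) bodyF₁ x])
      = ⊤ := by
  have hdet : (Matrix.of fun i j : Fin 3 =>
      ![bodyF₁ x, bodyF₂ x, lieBracket (lieBracket bodyF₁ bodyF₂) bodyF₁ x] j i).det = -2 := by
    rw [lieBracket_lieBracket_bodyF₁_bodyF₂_bodyF₁]
    simp [Matrix.det_fin_three, bodyF₁, bodyF₂]
  have hli : LinearIndependent ℝ
      ![bodyF₁ x, bodyF₂ x, lieBracket (lieBracket bodyF₁ bodyF₂) bodyF₁ x] :=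
    Matrix.linearIndependent_cols_of_det_ne_zero (hdet.trans_ne (by norm_num))
  exact ⟨hdet, hli, hli.span_eq_top_of_card_eq_finrank (by simp)⟩
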